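/- Let n_1, n_2 ≥ 1 be integers, n = n_1 + n_2 + 2, and G = B_n(n_1, n_2, 1, 1). Then ABC_GG(G) ≤ 2·sqrt((n−3)/(n−2)) + sqrt(2) + sqrt((n−4)/(n−3)) + (n−4)·sqrt((n−2)/(n−1)), with equality if and only if G = B_n(n−3, 1, 1, 1). -/

import Mathlib

/-- `sideCount G u v` is the number of vertices of `G` whose distance to `u`
is strictly smaller than their distance to `v`. -/
noncomputable def sideCount {V : Type*} [Fintype V] (G : SimpleGraph V) (u v : V) : ℕ :=
  Nat.card {w : V // G.dist w u < G.dist w v}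

open Classical in
/-- The Graovac–Ghorbani index
`ABC_GG(G) = Σ_{uv ∈ E(G)} sqrt ((n_u + n_v - 2) / (n_u * n_v))`,
computed as half the sum over ordered adjacent pairs. -/
noncomputable def ABCGG {V : Type*} [Fintype V] (G : SimpleGraph V) : ℝ :=
  (1 / 2) * ∑ u : V, ∑ v : V,
    if G.Adj u v then
      Real.sqrt (((sideCount G u v : ℝ) + (sideCount G v u : ℝ) - 2) /
        ((sideCount G u v : ℝ) * (sideCount G v u : ℝ)))
    else 0

/-- Vertex type for `B_n(n1,n2,n3,n4)`: the four vertices `v1,v2,v3,v4` of `Q_4`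
together with `n_i - 1` pendent vertices for each `i`. -/
abbrev BVert (n1 n2 n3 n4 : ℕ) : Type :=
  Fin 4 ⊕ Fin (n1 - 1) ⊕ Fin (n2 - 1) ⊕ Fin (n3 - 1) ⊕ Fin (n4 - 1)

/-- The graph `B_n(n1,n2,n3,n4)`: the 4-cycle `v1 v2 v3 v4` with chord `v1 v3`
(vertices `0,1,2,3` with chord `0–2`), and `n_i - 1` pendent vertices attached
to `v_i` for each `i = 1,2,3,4`. -/
def Bgraph (n1 n2 n3 n4 : ℕ) : SimpleGraph (BVert n1 n2 n3 n4) :=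
  SimpleGraph.fromRel (fun x y =>
    (x = Sum.inl 0 ∧ y = Sum.inl 1) ∨
    (x = Sum.inl 1 ∧ y = Sum.inl 2) ∨
    (x = Sum.inl 2 ∧ y = Sum.inl 3) ∨
    (x = Sum.inl 3 ∧ y = Sum.inl 0) ∨
    (x = Sum.inl 0 ∧ y = Sum.inl 2) ∨
    (∃ i : Fin (n1 - 1), x = Sum.inl 0 ∧ y = Sum.inr (Sum.inl i)) ∨
    (∃ i : Fin (n2 - 1), x = Sum.inl 1 ∧ y = Sum.inr (Sum.inr (Sum.inl i))) ∨
    (∃ i : Fin (n3 - 1), x = Sum.inl 2 ∧ y = Sum.inr (Sum.inr (Sum.inr (Sum.inl i)))) ∨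
    (∃ i : Fin (n4 - 1), x = Sum.inl 3 ∧ y = Sum.inr (Sum.inr (Sum.inr (Sum.inr i)))))

namespace SimpleGraph

/-- A function that is `1`-Lipschitz along edges, vanishes at `u` and can be decreased by moving
to a neighbour away from `u` is the distance to `u`. -/
theorem dist_eq_of_descent {V : Type*} (G : SimpleGraph V) {u : V} (f : V → ℕ) (hu : f u = 0)
    (hlip : ∀ v w, G.Adj v w → f v ≤ f w + 1)
    (hdesc : ∀ v, v ≠ u → ∃ w, G.Adj v w ∧ f w + 1 = f v) (v : V) : G.dist v u = f v := by
  have hwalk : ∀ k v, f v = k → ∃ p : G.Walk v u, p.length = k := by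
    intro k
    induction k with
    | zero =>
      intro v hv
      by_cases h : v = u
      · subst h
        exact ⟨Walk.nil, rfl⟩
      · obtain ⟨w, -, hw⟩ := hdesc v h
        omega
    | succ k ih =>
      intro v hv
      have h : v ≠ u := by
        rintro rfl
        omega
      obtain ⟨w, hvw, hw⟩ := hdesc v h
      obtain ⟨p, hp⟩ := ih w (by omega)
      exact ⟨Walk.cons hvw p, by simp [hp]⟩
  have hle : ∀ {v w : V} (p : G.Walk v w), f v ≤ f w + p.length := by
    intro v w p
    induction p with
    | nil => simp
    | cons h p ih =>
      have := hlip _ _ h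
      rw [Walk.length_cons]
      omega
  obtain ⟨p, hp⟩ := hwalk _ v rfl
  obtain ⟨q, hq⟩ := p.reachable.exists_walk_length_eq_dist
  have h1 := dist_le p
  have h2 := hle q
  omega

/-- Graph homomorphisms do not increase distances. -/
theorem edist_map_le {V W : Type*} {G : SimpleGraph V} {H : SimpleGraph W} (f : G →g H)
    (u v : V) : H.edist (f u) (f v) ≤ G.edist u v :=
  le_iInf fun p => by simpa using edist_le (p.map f)

/-- Graph isomorphisms preserve distances. -/
theorem Iso.dist_map_eq {V W : Type*} {G : SimpleGraph V} {H : SimpleGraph W} (e : G ≃g H)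
    (u v : V) : H.dist (e u) (e v) = G.dist u v := by
  have h1 := edist_map_le e.toHom u v
  have h2 := edist_map_le e.symm.toHom (e u) (e v)
  simp only [Iso.toHom, RelEmbedding.coe_toRelHom, RelIso.coe_toRelEmbedding,
    RelIso.symm_apply_apply] at h1 h2
  rw [dist, dist, le_antisymm h1 h2]

end SimpleGraph

theorem sideCount_iso {V W : Type*} [Fintype V] [Fintype W] {G : SimpleGraph V}
    {H : SimpleGraph W} (e : G ≃g H) (u v : V) :
    sideCount H (e u) (e v) = sideCount G u v := by
  refine (Nat.card_congr (e.toEquiv.subtypeEquiv fun w => ?_)).symm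
  simp [e.dist_map_eq]

/-- The Graovac–Ghorbani index is invariant under graph isomorphism. -/
theorem ABCGG_iso {V W : Type*} [Fintype V] [Fintype W] {G : SimpleGraph V}
    {H : SimpleGraph W} (e : G ≃g H) : ABCGG G = ABCGG H := by
  unfold ABCGG
  classical
  congr 1
  refine Fintype.sum_equiv e.toEquiv _ _ fun u => Fintype.sum_equiv e.toEquiv _ _ fun v => ?_
  simp only [RelIso.coe_fn_toEquiv, sideCount_iso e]
  exact if_congr e.map_adj_iff.symm rfl rfl

/-- The contribution of an edge to the Graovac–Ghorbani index. -/
noncomputable def edgeWeight {V : Type*} [Fintype V] (G : SimpleGraph V) (u v : V) : ℝ :=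
  Real.sqrt (((sideCount G u v : ℝ) + (sideCount G v u : ℝ) - 2) /
    ((sideCount G u v : ℝ) * (sideCount G v u : ℝ)))

theorem edgeWeight_comm {V : Type*} [Fintype V] (G : SimpleGraph V) (u v : V) :
    edgeWeight G u v = edgeWeight G v u := by
  rw [edgeWeight, edgeWeight, add_comm, mul_comm]

theorem ABCGG_eq_sum_edgeWeight {V : Type*} [Fintype V] (G : SimpleGraph V)
    [DecidableRel G.Adj] :
    ABCGG G = (1 / 2) * ∑ u : V, ∑ v : V, if G.Adj u v then edgeWeight G u v else 0 := by
  unfold ABCGG edgeWeight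
  congr! 5

namespace Bgraph

variable {n1 n2 n3 n4 : ℕ}

/-- The vertex of `Q_4` whose branch contains a given vertex. -/
def core : BVert n1 n2 n3 n4 → Fin 4 :=
  Sum.elim id (Sum.elim (fun _ => 0) (Sum.elim (fun _ => 1) (Sum.elim (fun _ => 2) fun _ => 3)))

/-- The distance of a vertex to `Q_4`: `1` for pendent vertices, `0` otherwise. -/
def depth : BVert n1 n2 n3 n4 → ℕ :=
  Sum.elim (fun _ => 0) fun _ => 1

/-- The distance in `Q_4`. -/
def coreDist (i j : Fin 4) : ℕ :=
  if i = j then 0 else if i ≠ 0 ∧ i ≠ 2 ∧ j ≠ 0 ∧ j ≠ 2 then 2 else 1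

/-- An explicit formula for the distance in `Bgraph`. -/
def explicitDist (x y : BVert n1 n2 n3 n4) : ℕ :=
  if x = y then 0 else depth x + depth y + coreDist (core x) (core y)

theorem coreDist_self (i : Fin 4) : coreDist i i = 0 := by simp [coreDist]

theorem coreDist_eq_zero (i j : Fin 4) : coreDist i j = 0 ↔ i = j := by
  revert i j
  decide

theorem coreDist_triangle (i j k : Fin 4) : coreDist i k ≤ coreDist i j + coreDist j k := by
  revert i j k
  decide

theorem exists_coreDist_descent {i j : Fin 4} (h : i ≠ j) :
    ∃ k, coreDist i k = 1 ∧ coreDist k j + 1 = coreDist i j := by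
  revert i j
  decide

@[simp] theorem core_inl (i : Fin 4) : core (Sum.inl i : BVert n1 n2 n3 n4) = i := rfl

@[simp] theorem depth_inl (i : Fin 4) : depth (Sum.inl i : BVert n1 n2 n3 n4) = 0 := rfl

@[simp] theorem depth_inr (x) : depth (Sum.inr x : BVert n1 n2 n3 n4) = 1 := rfl

theorem eq_inl_core_of_depth {x : BVert n1 n2 n3 n4} (h : depth x = 0) : x = Sum.inl (core x) := by
  rcases x with i | x
  · rfl
  · simp at h

theorem depth_le_one (x : BVert n1 n2 n3 n4) : depth x ≤ 1 := by
  rcases x with i | x <;> simp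

theorem explicitDist_le (x y : BVert n1 n2 n3 n4) :
    explicitDist x y ≤ depth x + depth y + coreDist (core x) (core y) := by
  unfold explicitDist
  split_ifs <;> omega

theorem explicitDist_inl (x : BVert n1 n2 n3 n4) (j : Fin 4) :
    explicitDist x (Sum.inl j) = depth x + coreDist (core x) j := by
  unfold explicitDist
  split_ifs with h
  · subst h
    simp [coreDist_self]
  · simp

theorem adj_iff (x y : BVert n1 n2 n3 n4) :
    (Bgraph n1 n2 n3 n4).Adj x y ↔ explicitDist x y = 1 := by
  rcases x with i | x <;> rcases y with j | y
  · rw [explicitDist_inl, depth_inl, core_inl, zero_add]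
    simp only [Bgraph, coreDist, SimpleGraph.fromRel_adj, Sum.inl.injEq, reduceCtorEq,
      and_false, exists_false, or_false, ne_eq]
    revert i j
    decide
  · rcases y with j | j | j | j <;> fin_cases i <;>
      simp [Bgraph, explicitDist, core, coreDist]
  · rcases x with i | i | i | i <;> fin_cases j <;>
      simp [Bgraph, explicitDist, core, coreDist]
  · have h : explicitDist (Sum.inr x) (Sum.inr y : BVert n1 n2 n3 n4) ≠ 1 := by
      unfold explicitDist
      split_ifs <;> simp
      omega
    simpa [Bgraph] using h

theorem dist_eq (x y : BVert n1 n2 n3 n4) :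
    (Bgraph n1 n2 n3 n4).dist x y = explicitDist x y := by
  refine SimpleGraph.dist_eq_of_descent _ (fun x => explicitDist x y) (by simp [explicitDist])
    (fun v w h => ?_) (fun v hv => ?_) x
  · rw [adj_iff] at h
    by_cases hwy : w = y
    · subst hwy
      omega
    have hvw : v ≠ w := by
      rintro rfl
      simp [explicitDist] at h
    have := explicitDist_le v y
    have := coreDist_triangle (core v) (core w) (core y)
    simp only [explicitDist, if_neg hwy, if_neg hvw] at h this ⊢
    split_ifs <;> omega
  · simp only [adj_iff]
    have hd := depth_le_one v
    by_cases hv0 : depth v = 0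
    · by_cases hc : core v = core y
      · have hy := depth_le_one y
        have hy0 : depth y ≠ 0 := fun h => hv <| by
          rw [eq_inl_core_of_depth hv0, eq_inl_core_of_depth h, hc]
        refine ⟨y, ?_, ?_⟩
        · rw [explicitDist, if_neg hv, hc, coreDist_self]
          omega
        · rw [explicitDist, explicitDist, if_neg hv, if_pos rfl, hc, coreDist_self]
          omega
      · obtain ⟨k, h1, h2⟩ := exists_coreDist_descent hc
        refine ⟨Sum.inl k, by rw [explicitDist_inl]; omega, ?_⟩
        rw [explicitDist, explicitDist, if_neg hv, core_inl, depth_inl]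
        split_ifs with h
        · subst h
          simp_all
        · omega
    · refine ⟨Sum.inl (core v), by rw [explicitDist_inl, coreDist_self]; omega, ?_⟩
      rw [explicitDist, explicitDist, if_neg hv, core_inl, depth_inl]
      split_ifs with h
      · subst h
        simp [coreDist_self]
        omega
      · omega

theorem sum_core (h1 : 1 ≤ n1) (h2 : 1 ≤ n2) (h3 : 1 ≤ n3) (h4 : 1 ≤ n4) (f : Fin 4 → ℕ) :
    ∑ x : BVert n1 n2 n3 n4, f (core x) = ∑ k, ![n1, n2, n3, n4] k * f k := by
  obtain ⟨m1, rfl⟩ := Nat.exists_eq_add_of_le' h1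
  obtain ⟨m2, rfl⟩ := Nat.exists_eq_add_of_le' h2
  obtain ⟨m3, rfl⟩ := Nat.exists_eq_add_of_le' h3
  obtain ⟨m4, rfl⟩ := Nat.exists_eq_add_of_le' h4
  simp [Fintype.sum_sum_type, core, Fin.sum_univ_four]
  ring

theorem sideCount_inl (h1 : 1 ≤ n1) (h2 : 1 ≤ n2) (h3 : 1 ≤ n3) (h4 : 1 ≤ n4) (i j : Fin 4) :
    sideCount (Bgraph n1 n2 n3 n4) (Sum.inl i) (Sum.inl j) =
      ∑ k, if coreDist k i < coreDist k j then ![n1, n2, n3, n4] k else 0 := by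
  classical
  rw [sideCount, Nat.card_eq_fintype_card, Fintype.card_subtype, Finset.card_filter]
  simp only [dist_eq, explicitDist_inl, Nat.add_lt_add_iff_left]
  simpa using sum_core h1 h2 h3 h4 fun k => if coreDist k i < coreDist k j then 1 else 0

theorem dist_inr_lt_iff (x) (w : BVert n1 n2 n3 n4) :
    (Bgraph n1 n2 n3 n4).dist w (Sum.inr x) <
        (Bgraph n1 n2 n3 n4).dist w (Sum.inl (core (Sum.inr x : BVert n1 n2 n3 n4))) ↔
      w = Sum.inr x := by
  rw [dist_eq, dist_eq, explicitDist_inl]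
  unfold explicitDist
  split_ifs with h
  · simp [h]
  · simp [h]

theorem dist_lt_inr_iff (x) (w : BVert n1 n2 n3 n4) :
    (Bgraph n1 n2 n3 n4).dist w (Sum.inl (core (Sum.inr x : BVert n1 n2 n3 n4))) <
        (Bgraph n1 n2 n3 n4).dist w (Sum.inr x) ↔
      w ≠ Sum.inr x := by
  rw [dist_eq, dist_eq, explicitDist_inl]
  unfold explicitDist
  split_ifs with h
  · simp [h]
  · simp [h]

theorem sideCount_inr_core (x) :
    sideCount (Bgraph n1 n2 n3 n4) (Sum.inr x)
      (Sum.inl (core (Sum.inr x : BVert n1 n2 n3 n4))) = 1 := by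
  simp only [sideCount, dist_inr_lt_iff]
  simp

theorem sideCount_core_inr (h1 : 1 ≤ n1) (h2 : 1 ≤ n2) (h3 : 1 ≤ n3) (h4 : 1 ≤ n4) (x) :
    sideCount (Bgraph n1 n2 n3 n4) (Sum.inl (core (Sum.inr x : BVert n1 n2 n3 n4)))
      (Sum.inr x) = n1 + n2 + n3 + n4 - 1 := by
  simp only [sideCount, dist_lt_inr_iff]
  simp
  omega

theorem adj_inr_inl (x) (j : Fin 4) :
    (Bgraph n1 n2 n3 n4).Adj (Sum.inr x) (Sum.inl j) ↔
      core (Sum.inr x : BVert n1 n2 n3 n4) = j := by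
  rw [adj_iff, explicitDist_inl, depth_inr, ← coreDist_eq_zero]
  omega

theorem not_adj_inr_inr (x y) : ¬ (Bgraph n1 n2 n3 n4).Adj (Sum.inr x) (Sum.inr y) := by
  rw [adj_iff, explicitDist]
  split_ifs
  · simp
  · simp
    omega

theorem adj_inl_inl (i j : Fin 4) :
    (Bgraph n1 n2 n3 n4).Adj (Sum.inl i) (Sum.inl j) ↔ coreDist i j = 1 := by
  rw [adj_iff, explicitDist_inl, depth_inl, core_inl, zero_add]

/-- The Graovac–Ghorbani index of `Bgraph`, with the contribution of pendent edges evaluated. -/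
theorem ABCGG_eq_core_add_pendent (h1 : 1 ≤ n1) (h2 : 1 ≤ n2) (h3 : 1 ≤ n3) (h4 : 1 ≤ n4)
    {n : ℕ} (hn : n = n1 + n2 + n3 + n4) :
    ABCGG (Bgraph n1 n2 n3 n4) =
      (1 / 2) * (∑ i : Fin 4, ∑ j : Fin 4, if coreDist i j = 1 then
        edgeWeight (Bgraph n1 n2 n3 n4) (Sum.inl i) (Sum.inl j) else 0) +
      ((n : ℝ) - 4) * Real.sqrt (((n : ℝ) - 2) / ((n : ℝ) - 1)) := by
  classical
  have hpend : ∀ x, ∑ j : Fin 4, (if (Bgraph n1 n2 n3 n4).Adj (Sum.inr x) (Sum.inl j) then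
      edgeWeight (Bgraph n1 n2 n3 n4) (Sum.inr x) (Sum.inl j) else 0) =
      Real.sqrt (((n : ℝ) - 2) / ((n : ℝ) - 1)) := by
    intro x
    simp only [adj_inr_inl, Finset.sum_ite_eq, Finset.mem_univ, if_true]
    rw [edgeWeight, sideCount_inr_core, sideCount_core_inr h1 h2 h3 h4, ← hn,
      Nat.cast_sub (by omega)]
    congr 1
    push_cast
    ring
  have hpend' : ∑ i : Fin 4, ∑ x, (if (Bgraph n1 n2 n3 n4).Adj (Sum.inl i) (Sum.inr x) then
      edgeWeight (Bgraph n1 n2 n3 n4) (Sum.inl i) (Sum.inr x) else 0) =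
      ∑ x, ∑ j : Fin 4, (if (Bgraph n1 n2 n3 n4).Adj (Sum.inr x) (Sum.inl j) then
      edgeWeight (Bgraph n1 n2 n3 n4) (Sum.inr x) (Sum.inl j) else 0) := by
    rw [Finset.sum_comm]
    simp only [SimpleGraph.adj_comm _ (Sum.inl _) (Sum.inr _),
      edgeWeight_comm _ (Sum.inl _) (Sum.inr _)]
  rw [ABCGG_eq_sum_edgeWeight, Fintype.sum_sum_type]
  simp only [Fintype.sum_sum_type (α₁ := Fin 4), Finset.sum_add_distrib, hpend']
  simp only [hpend, not_adj_inr_inr, adj_inl_inl, if_false, Finset.sum_const_zero,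
    Finset.sum_const, nsmul_eq_mul, Finset.card_univ]
  have hcard : (Fintype.card (Fin (n1 - 1) ⊕ Fin (n2 - 1) ⊕ Fin (n3 - 1) ⊕ Fin (n4 - 1)) : ℝ) =
      (n : ℝ) - 4 := by
    rw [eq_sub_iff_add_eq]
    norm_cast
    simp
    omega
  rw [hcard]
  ring

/-- The Graovac–Ghorbani index of `B_n(n1, n2, 1, 1)`. -/
theorem ABCGG_one_one {a b n : ℕ} (ha : 1 ≤ a) (hb : 1 ≤ b) (hn : n = a + b + 2) :
    ABCGG (Bgraph a b 1 1) =
      Real.sqrt (((n : ℝ) - 3) / ((a + 1) * b)) + Real.sqrt (1 / 2) +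
      Real.sqrt ((b : ℝ) / (b + 1)) + Real.sqrt (((n : ℝ) - 3) / (n - 2)) +
      Real.sqrt (((a : ℝ) - 1) / a) +
      ((n : ℝ) - 4) * Real.sqrt (((n : ℝ) - 2) / ((n : ℝ) - 1)) := by
  have hb0 : (b : ℝ) ≠ 0 := by positivity
  rw [ABCGG_eq_core_add_pendent ha hb le_rfl le_rfl (by omega : n = a + b + 1 + 1)]
  congr 1
  have hcount := sideCount_inl ha hb le_rfl le_rfl
  have w01 : edgeWeight (Bgraph a b 1 1) (Sum.inl 0) (Sum.inl 1) =
      Real.sqrt (((n : ℝ) - 3) / ((a + 1) * b)) := by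
    simp only [edgeWeight, hcount]
    congr 1
    simp [coreDist, Fin.sum_univ_four, hn]
    ring
  have w12 : edgeWeight (Bgraph a b 1 1) (Sum.inl 1) (Sum.inl 2) = Real.sqrt (1 / 2) := by
    simp only [edgeWeight, hcount]
    congr 1
    simp [coreDist, Fin.sum_univ_four]
    field_simp
  have w23 : edgeWeight (Bgraph a b 1 1) (Sum.inl 2) (Sum.inl 3) =
      Real.sqrt ((b : ℝ) / (b + 1)) := by
    simp only [edgeWeight, hcount]
    congr 1
    simp [coreDist, Fin.sum_univ_four]
    ring
  have w03 : edgeWeight (Bgraph a b 1 1) (Sum.inl 0) (Sum.inl 3) =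
      Real.sqrt (((n : ℝ) - 3) / (n - 2)) := by
    simp only [edgeWeight, hcount]
    congr 1
    simp [coreDist, Fin.sum_univ_four, hn]
    ring
  have w02 : edgeWeight (Bgraph a b 1 1) (Sum.inl 0) (Sum.inl 2) =
      Real.sqrt (((a : ℝ) - 1) / a) := by
    simp only [edgeWeight, hcount]
    congr 1
    simp [coreDist, Fin.sum_univ_four]
    ring
  have hcomm := edgeWeight_comm (Bgraph a b 1 1)
  simp only [Fin.sum_univ_four, hcomm (Sum.inl 1) (Sum.inl 0), hcomm (Sum.inl 2) (Sum.inl 0),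
    hcomm (Sum.inl 3) (Sum.inl 0), hcomm (Sum.inl 2) (Sum.inl 1), hcomm (Sum.inl 3) (Sum.inl 2),
    w01, w12, w23, w03, w02]
  simp only [coreDist, Fin.reduceEq, ne_eq, not_true, not_false_eq_true, and_true,
    and_false, if_true, if_false, zero_ne_one, OfNat.ofNat_ne_one]
  ring

end Bgraph

theorem stmt17 (n1 n2 n : ℕ) (h1 : 1 ≤ n1) (h2 : 1 ≤ n2)
    (hn : n = n1 + n2 + 2) :
    ABCGG (Bgraph n1 n2 1 1) ≤ 2 * Real.sqrt (((n : ℝ) - 3) / ((n : ℝ) - 2)) +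
      Real.sqrt 2 + Real.sqrt (((n : ℝ) - 4) / ((n : ℝ) - 3)) +
      ((n : ℝ) - 4) * Real.sqrt (((n : ℝ) - 2) / ((n : ℝ) - 1)) ∧
    (ABCGG (Bgraph n1 n2 1 1) = 2 * Real.sqrt (((n : ℝ) - 3) / ((n : ℝ) - 2)) +
        Real.sqrt 2 + Real.sqrt (((n : ℝ) - 4) / ((n : ℝ) - 3)) +
        ((n : ℝ) - 4) * Real.sqrt (((n : ℝ) - 2) / ((n : ℝ) - 1)) ↔
      Nonempty (Bgraph n1 n2 1 1 ≃g Bgraph (n - 3) 1 1 1)) := by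
  have hmain := Bgraph.ABCGG_one_one h1 h2 hn
  have hext := Bgraph.ABCGG_one_one (a := n - 3) (b := 1) (n := n) (by omega) le_rfl (by omega)
  have hcast : ((n - 3 : ℕ) : ℝ) = (n : ℝ) - 3 := by
    rw [Nat.cast_sub (by omega)]
    norm_num
  have hval : ABCGG (Bgraph (n - 3) 1 1 1) =
      2 * Real.sqrt (((n : ℝ) - 3) / ((n : ℝ) - 2)) +
        Real.sqrt 2 + Real.sqrt (((n : ℝ) - 4) / ((n : ℝ) - 3)) +
        ((n : ℝ) - 4) * Real.sqrt (((n : ℝ) - 2) / ((n : ℝ) - 1)) := by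
    have hsqrt : Real.sqrt 2 = 2 * Real.sqrt (1 / 2) := by
      rw [show (2 : ℝ) = 2 ^ 2 * (1 / 2) by norm_num, Real.sqrt_mul (by norm_num),
        Real.sqrt_sq (by norm_num)]
      norm_num
    rw [hext, hcast, hsqrt, show ((n : ℝ) - 3 + 1) * ((1 : ℕ) : ℝ) = n - 2 by push_cast; ring,
      show (n : ℝ) - 3 - 1 = n - 4 by ring]
    norm_num
    ring
  have hlt : n2 ≠ 1 → ABCGG (Bgraph n1 n2 1 1) < ABCGG (Bgraph (n - 3) 1 1 1) := by
    intro h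
    rw [hmain, hext, hcast]
    have ha : (1 : ℝ) ≤ n1 := by exact_mod_cast h1
    have hb : (2 : ℝ) ≤ n2 := by exact_mod_cast (by omega : 2 ≤ n2)
    have hn' : (n : ℝ) = n1 + n2 + 2 := by exact_mod_cast hn
    have e1 : Real.sqrt (((n : ℝ) - 3) / ((n1 + 1) * n2)) ≤ Real.sqrt (1 / 2) := by
      apply Real.sqrt_le_sqrt
      rw [div_le_div_iff₀ (by positivity) (by norm_num)]
      nlinarith
    have e2 : Real.sqrt ((n2 : ℝ) / (n2 + 1)) ≤ Real.sqrt (((n : ℝ) - 3) / (n - 3 + 1)) := by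
      apply Real.sqrt_le_sqrt
      rw [div_le_div_iff₀ (by positivity) (by linarith)]
      nlinarith
    have e3 : Real.sqrt (((n1 : ℝ) - 1) / n1) < Real.sqrt (((n : ℝ) - 3 - 1) / (n - 3)) := by
      apply Real.sqrt_lt_sqrt (div_nonneg (by linarith) (by linarith))
      rw [div_lt_div_iff₀ (by positivity) (by linarith)]
      nlinarith
    norm_num at e1 e2 e3 ⊢
    linarith
  rw [← hval]
  refine ⟨?_, fun h => ?_, fun ⟨e⟩ => ABCGG_iso e⟩
  · by_cases h : n2 = 1
    · obtain rfl : n1 = n - 3 := by omega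
      rw [h]
    · exact (hlt h).le
  · have h : n2 = 1 := by
      by_contra hne
      exact (hlt hne).ne h
    subst h
    obtain rfl : n1 = n - 3 := by omega
    exact ⟨SimpleGraph.Iso.refl⟩
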